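/- Let M ≥ 1 and let D : Fin M → Fin M → ℝ have pairwise distinct values (D i j = D k l implies i = k and j = l). Let (i₀, j₀) be the pair minimizing D over all of Fin M × Fin M. Then every stable matching σ : Fin M ≃ Fin M satisfies σ i₀ = j₀. -/

import Mathlib

/-- A matching `σ` between BL chunks and EL chunks is stable if it admits no
blocking pair `(i, j)`, i.e. no pair with `D i j < D i (σ i)` and
`D i j < D (σ.symm j) j`. -/
def IsStableMatching {M : ℕ} (D : Fin M → Fin M → ℝ) (σ : Fin M ≃ Fin M) : Prop :=
  ¬ ∃ i j : Fin M, D i j < D i (σ i) ∧ D i j < D (σ.symm j) j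

/-- Key lemma behind Remark 1: if `D` has pairwise distinct values and
`(i₀, j₀)` minimizes `D` over all pairs, then every stable matching pairs
`i₀` with `j₀`. -/
theorem stable_matching_pairs_global_min
    (M : ℕ) (hM : 1 ≤ M) (D : Fin M → Fin M → ℝ)
    (hdist : ∀ i j k l : Fin M, D i j = D k l → i = k ∧ j = l)
    (i₀ j₀ : Fin M) (hmin : ∀ i j : Fin M, D i₀ j₀ ≤ D i j)
    (σ : Fin M ≃ Fin M) (hσ : IsStableMatching D σ) :
    σ i₀ = j₀ := by
  by_contra hne
  refine hσ ⟨i₀, j₀, lt_of_le_of_ne (hmin _ _) fun h => ?_, lt_of_le_of_ne (hmin _ _) fun h => ?_⟩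
  · exact hne (hdist _ _ _ _ h).2.symm
  · exact hne ((Equiv.eq_symm_apply σ).mp (hdist _ _ _ _ h).1)
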